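/- arXiv:2501.07966 — 2 statements merged into one kernel-verified Lean document; each statement's English description precedes it below -/
import Mathlib

section
/- Let x be the horizontal component of the Peano curve, and let (r_n) be a sequence of real numbers such that for each n the number r_n is not an integer multiple of 3^{-n}. Then for every t ∈ [0,1], the quadratic variations of x along the Lebesgue partitions for the grids 3^{-n}ℤ + r_n converge: lim_{n→∞} [x]_t^{3^{-n}, r_n} = t/4. -/
open scoped BigOperators Classical
open Filter

noncomputable section

/-- The digit map `k n = 2 - n` on `{0,1,2}` (with truncated natural subtraction). -/
def peanoK : ℕ → ℕ := fun n => 2 - n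

/-- The `m`-th (0-indexed) ternary digit of the horizontal component of the Peano curve
evaluated at the point with ternary digits `d` (0-indexed, i.e. `t_j = d (j-1)`):
the `j`-th digit of `x(t)` is `k^[t_2 + t_4 + ⋯ + t_{2j-2}] (t_{2j-1})`. -/
def peanoXDigit (d : ℕ → Fin 3) (m : ℕ) : ℕ :=
  peanoK^[∑ i ∈ Finset.range m, (d (2 * i + 1) : ℕ)] (d (2 * m) : ℕ)

/-- `x : ℝ → ℝ` is (on `[0,1]`) the horizontal component of the Peano curve:
for every ternary expansion `t = Σ_j d_j 3^{-(j+1)}`, `x t` is given by the digit formula. -/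
def IsPeanoX (x : ℝ → ℝ) : Prop :=
  ∀ d : ℕ → Fin 3,
    x (∑' j : ℕ, (d j : ℝ) / 3 ^ (j + 1)) = ∑' m : ℕ, (peanoXDigit d m : ℝ) / 3 ^ (m + 1)

/-- The grid `cℤ + r = {cq + r : q ∈ ℤ}`. -/
def peanoGrid (c r : ℝ) : Set ℝ := {u : ℝ | ∃ q : ℤ, u = c * q + r}

/-- `lebTime x c r m` is the time `t_{m+1}(c,r)` of the Lebesgue partition `π(c,r)` for `x`
on `[0,1]` (values in `[0,1] ∪ {+∞}`, modelled in `EReal`; `sInf ∅ = ⊤ = +∞`). -/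
def lebTime (x : ℝ → ℝ) (c r : ℝ) : ℕ → EReal
  | 0 => sInf (Real.toEReal '' {t : ℝ | t ∈ Set.Icc (0 : ℝ) 1 ∧ x t ∈ peanoGrid c r})
  | m + 1 =>
    if lebTime x c r m = ⊤ then ⊤
    else
      sInf (Real.toEReal ''
        {t : ℝ | t ∈ Set.Icc ((lebTime x c r m).toReal) 1 ∧ x t ∈ peanoGrid c r ∧
          x t ≠ x ((lebTime x c r m).toReal)})

/-- `k(c,r,t) = min{m ∈ ℕ₊ : t_m(c,r) ≥ t}` (recall `t_m(c,r) = lebTime x c r (m-1)`). -/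
def kIdx (x : ℝ → ℝ) (c r t : ℝ) : ℕ :=
  sInf {m : ℕ | 1 ≤ m ∧ (t : EReal) ≤ lebTime x c r (m - 1)}

/-- `l(c,r,t) = max{m ∈ ℕ₊ : t_m(c,r) ≤ t}`. -/
def lIdx (x : ℝ → ℝ) (c r t : ℝ) : ℕ :=
  sSup {m : ℕ | 1 ≤ m ∧ lebTime x c r (m - 1) ≤ (t : EReal)}

/-- The quadratic variation `[x]_{s,t}^{c,r}` of `x` on `[s,t]` along the Lebesgue partition
`π(c,r)`: the sum over `m = k(c,r,s), …, l(c,r,t) - 1` of `(x(t_{m+1}) - x(t_m))²`. -/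
def qvar (x : ℝ → ℝ) (c r s t : ℝ) : ℝ :=
  ∑ m ∈ Finset.Ico (kIdx x c r s) (lIdx x c r t),
    (x ((lebTime x c r m).toReal) - x ((lebTime x c r (m - 1)).toReal)) ^ 2

/-- `[x]_t^{c,r} := [x]_{0,t}^{c,r}`. -/
def qvar0 (x : ℝ → ℝ) (c r t : ℝ) : ℝ := qvar x c r 0 t

/-- The ternary digits of `x t`, as elements of `Fin 3`, in terms of those of `t`. -/
def peanoXFin (d : ℕ → Fin 3) (m : ℕ) : Fin 3 :=
  if Even (∑ i ∈ Finset.range m, (d (2 * i + 1) : ℕ)) then d (2 * m) else (d (2 * m)).rev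

theorem peanoK_iterate (v : ℕ) (a : Fin 3) :
    peanoK^[v] (a : ℕ) = ((if Even v then a else a.rev : Fin 3) : ℕ) := by
  induction v with
  | zero => simp
  | succ v ih =>
    rw [Function.iterate_succ_apply', ih]
    by_cases h : Even v <;> (simp [h, Nat.even_add_one, peanoK, Fin.val_rev]; try omega)

theorem peanoXDigit_eq (d : ℕ → Fin 3) (m : ℕ) : peanoXDigit d m = (peanoXFin d m : ℕ) :=
  peanoK_iterate _ _

theorem IsPeanoX.ofDigits {x : ℝ → ℝ} (hx : IsPeanoX x) (d : ℕ → Fin 3) :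
    x (Real.ofDigits d) = Real.ofDigits (peanoXFin d) := by
  simpa [Real.ofDigits, Real.ofDigitsTerm, peanoXDigit_eq, div_eq_mul_inv] using hx d

theorem exists_ofDigits_eq {t : ℝ} (ht : t ∈ Set.Icc (0 : ℝ) 1) :
    ∃ d : ℕ → Fin 3, Real.ofDigits d = t := by
  obtain ⟨d, -, hd⟩ := Real.ofDigits_SurjOn (b := 3) (by norm_num) ht
  exact ⟨d, hd⟩

theorem IsPeanoX.mem_Icc {x : ℝ → ℝ} (hx : IsPeanoX x) {t : ℝ} (ht : t ∈ Set.Icc (0 : ℝ) 1) :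
    x t ∈ Set.Icc (0 : ℝ) 1 := by
  obtain ⟨d, rfl⟩ := exists_ofDigits_eq ht
  rw [hx.ofDigits]
  exact ⟨Real.ofDigits_nonneg _, Real.ofDigits_le_one _⟩

theorem continuous_peanoXFin : Continuous peanoXFin := by
  refine continuous_pi fun m => ?_
  have h : Continuous fun d : ℕ → Fin 3 =>
      ((∑ i ∈ Finset.range m, ((d (2 * i + 1) : Fin 3) : ℕ)), d (2 * m)) := by
    refine Continuous.prodMk (continuous_finsetSum _ fun i _ => ?_) (continuous_apply _)
    exact (continuous_of_discreteTopology (f := fun a : Fin 3 => (a : ℕ))).comp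
      (continuous_apply _)
  exact (continuous_of_discreteTopology
    (f := fun u : ℕ × Fin 3 => if Even u.1 then u.2 else u.2.rev)).comp h

theorem IsPeanoX.continuousOn {x : ℝ → ℝ} (hx : IsPeanoX x) :
    ContinuousOn x (Set.Icc (0 : ℝ) 1) := by
  let D : (ℕ → Fin 3) → Set.Icc (0 : ℝ) 1 := fun d =>
    ⟨Real.ofDigits d, Real.ofDigits_nonneg d, Real.ofDigits_le_one d⟩
  have hD : Continuous D := Real.continuous_ofDigits.subtype_mk _
  have hsurj : Function.Surjective D := fun t => by
    obtain ⟨d, hd⟩ := exists_ofDigits_eq t.2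
    exact ⟨d, Subtype.ext hd⟩
  rw [continuousOn_iff_continuous_domRestrict,
    (hD.isClosedMap.isQuotientMap hD hsurj).continuous_iff]
  have : (Set.Icc (0 : ℝ) 1).domRestrict x ∘ D = fun d => Real.ofDigits (peanoXFin d) :=
    funext fun d => hx.ofDigits d
  rw [this]
  exact Real.continuous_ofDigits.comp continuous_peanoXFin

theorem ofDigits_fin_rev (d : ℕ → Fin 3) :
    Real.ofDigits (fun m => (d m).rev) = 1 - Real.ofDigits d := by
  rw [eq_sub_iff_add_eq, ← Real.ofDigits_const_last_eq_one 2]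
  simp only [Real.ofDigits]
  rw [← Summable.tsum_add Real.summable_ofDigitsTerm Real.summable_ofDigitsTerm]
  refine tsum_congr fun m => ?_
  simp only [Real.ofDigitsTerm, ← add_mul]
  congr 1
  have : (((d m).rev : ℕ) : ℝ) + ((d m : ℕ) : ℝ) = ((2 : ℕ) : ℝ) := by
    rw [← Nat.cast_add, Fin.val_rev]
    congr 1
    omega
  rw [this]
  simp

theorem ofDigits_eq_head_add (d : ℕ → Fin 3) :
    Real.ofDigits d = ((d 0 : ℕ) : ℝ) / 3 + Real.ofDigits (fun m => d (m + 1)) / 3 := by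
  rw [Real.ofDigits_eq_sum_add_ofDigits d 1]
  simp [Real.ofDigitsTerm]
  ring

/-- The two-digit self-similarity of `x`, in a form symmetric under `y ↦ 1 - y`. -/
theorem IsPeanoX.self_similar {x : ℝ → ℝ} (hx : IsPeanoX x) (a b : Fin 3) {s : ℝ}
    (hs : s ∈ Set.Icc (0 : ℝ) 1) :
    6 * x ((3 * ((a : ℕ) : ℝ) + ((b : ℕ) : ℝ) + s) / 9) =
      2 * ((a : ℕ) : ℝ) + 1 + (if (b : ℕ) = 1 then -1 else 1) * (2 * x s - 1) := by
  obtain ⟨d, rfl⟩ := exists_ofDigits_eq hs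
  let d' : ℕ → Fin 3 := fun m => Nat.casesOn m a fun m => Nat.casesOn m b d
  have h1 : (3 * ((a : ℕ) : ℝ) + ((b : ℕ) : ℝ) + Real.ofDigits d) / 9 = Real.ofDigits d' := by
    rw [ofDigits_eq_head_add d', ofDigits_eq_head_add (fun m => d' (m + 1))]
    change _ = ((a : ℕ) : ℝ) / 3 + (((b : ℕ) : ℝ) / 3 + Real.ofDigits d / 3) / 3
    ring
  have h2 (m : ℕ) : peanoXFin d' (m + 1) =
      if (b : ℕ) = 1 then (peanoXFin d m).rev else peanoXFin d m := by
    have hsum : ∑ i ∈ Finset.range (m + 1), (d' (2 * i + 1) : ℕ) =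
        (∑ i ∈ Finset.range m, (d (2 * i + 1) : ℕ)) + b := by
      rw [Finset.sum_range_succ']
      rfl
    have hd : d' (2 * (m + 1)) = d (2 * m) := rfl
    unfold peanoXFin
    rw [hsum, hd]
    generalize (∑ i ∈ Finset.range m, (d (2 * i + 1) : ℕ)) = v
    have hb : Even (b : ℕ) ↔ (b : ℕ) ≠ 1 := by
      have := b.isLt
      rw [Nat.even_iff]
      omega
    by_cases h : (b : ℕ) = 1 <;> by_cases hv : Even v <;> simp [Nat.even_add, hb, h, hv]
  rw [h1, hx.ofDigits, hx.ofDigits, ofDigits_eq_head_add (peanoXFin d')]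
  have h0 : peanoXFin d' 0 = a := by simp [peanoXFin, d']
  simp only [h0, h2]
  split_ifs
  · rw [ofDigits_fin_rev]
    ring
  · ring

theorem IsPeanoX.apply_zero {x : ℝ → ℝ} (hx : IsPeanoX x) : x 0 = 0 := by
  have h := hx.self_similar 0 0 (s := 0) (by simp)
  norm_num at h
  linarith

theorem IsPeanoX.apply_one {x : ℝ → ℝ} (hx : IsPeanoX x) : x 1 = 1 := by
  have h := hx.self_similar 2 2 (s := 1) (by simp)
  norm_num at h
  linarith

theorem IsPeanoX.surjOn {x : ℝ → ℝ} (hx : IsPeanoX x) :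
    Set.SurjOn x (Set.Icc (0 : ℝ) 1) (Set.Icc (0 : ℝ) 1) := by
  have h := intermediate_value_Icc zero_le_one hx.continuousOn
  rwa [hx.apply_zero, hx.apply_one] at h

/-- Boundaries `i + 1` between consecutive time blocks across which the cell containing the values
of `x` changes. -/
def IsCellChange (i : ℕ) : Prop := Odd (padicValNat 3 (i + 1))

theorem isCellChange_nine_mul_add_eight {k : ℕ} : IsCellChange (9 * k + 8) ↔ IsCellChange k := by
  have h : 9 * k + 8 + 1 = 3 * (3 * (k + 1)) := by ring
  rw [IsCellChange, IsCellChange, h, padicValNat.mul (by norm_num) (by omega),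
    padicValNat.mul (by norm_num) (by omega), padicValNat.self (by norm_num)]
  grind

theorem isCellChange_nine_mul_add_iff {k j : ℕ} (hj : j < 8) :
    IsCellChange (9 * k + j) ↔ j = 2 ∨ j = 5 := by
  unfold IsCellChange
  by_cases h : j = 2 ∨ j = 5
  · have h1 : padicValNat 3 (9 * k + j + 1) = 1 := by
      obtain ⟨u, hu, hu'⟩ : ∃ u, 9 * k + j + 1 = 3 * u ∧ ¬ 3 ∣ u := by
        rcases h with rfl | rfl
        · exact ⟨3 * k + 1, by ring, by omega⟩
        · exact ⟨3 * k + 2, by ring, by omega⟩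
      rw [hu, padicValNat.mul (by norm_num) (by omega), padicValNat.self (by norm_num),
        padicValNat.eq_zero_of_not_dvd hu']
    simp [h1, h]
  · rw [padicValNat.eq_zero_of_not_dvd (by omega)]
    simp [h]

/-- On the `i`-th interval of length `9⁻ⁿ`, `x` is a rescaled copy of itself with values in the
cell `[p i / 3ⁿ, (p i + 1) / 3ⁿ]`, traversed with orientation `e i = ±1`. -/
theorem IsPeanoX.exists_blocks {x : ℝ → ℝ} (hx : IsPeanoX x) (n : ℕ) :
    ∃ p e : ℕ → ℤ, ∀ i < 9 ^ n, (e i = 1 ∨ e i = -1) ∧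
      (∀ s ∈ Set.Icc (0 : ℝ) 1,
        2 * 3 ^ n * x ((i + s) / 9 ^ n) = 2 * p i + 1 + e i * (2 * x s - 1)) ∧
      (i + 1 < 9 ^ n →
        if IsCellChange i then p (i + 1) = p i + e i ∧ e (i + 1) = e i
        else p (i + 1) = p i ∧ e (i + 1) = - e i) := by
  induction n with
  | zero =>
    refine ⟨fun _ => 0, fun _ => 1, fun i hi => ⟨Or.inl rfl, fun s _ => ?_, fun h => ?_⟩⟩
    · obtain rfl : i = 0 := by simpa using hi
      simp
    · simp at h
  | succ n ih =>
    obtain ⟨p, e, h⟩ := ih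
    refine ⟨fun i => 3 * p (i / 9) + 1 + e (i / 9) * (((i % 9 / 3 : ℕ) : ℤ) - 1),
      fun i => e (i / 9) * if i % 3 = 1 then -1 else 1, fun i hi => ?_⟩
    have hk : i / 9 < 9 ^ n := by rw [pow_succ] at hi; omega
    obtain ⟨he, hs, hc⟩ := h _ hk
    refine ⟨?_, fun s hs' => ?_, fun hi' => ?_⟩
    · rcases he with he | he <;> simp only [he] <;> split_ifs <;> simp
    · have ha : i % 9 / 3 < 3 := by omega
      have hb : i % 3 < 3 := by omega
      have hself := hx.self_similar ⟨_, ha⟩ ⟨_, hb⟩ hs'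
      have hi0 : (i : ℝ) = 9 * ((i / 9 : ℕ) : ℝ) + 3 * ((i % 9 / 3 : ℕ) : ℝ) +
          ((i % 3 : ℕ) : ℝ) := by
        have : i = 9 * (i / 9) + 3 * (i % 9 / 3) + i % 3 := by omega
        exact_mod_cast this
      have ha' : ((i % 9 / 3 : ℕ) : ℝ) ≤ 2 := by exact_mod_cast Nat.le_of_lt_succ ha
      have hb' : ((i % 3 : ℕ) : ℝ) ≤ 2 := by exact_mod_cast Nat.le_of_lt_succ hb
      have ha0 : (0 : ℝ) ≤ ((i % 9 / 3 : ℕ) : ℝ) := Nat.cast_nonneg _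
      have hb0 : (0 : ℝ) ≤ ((i % 3 : ℕ) : ℝ) := Nat.cast_nonneg _
      simp only at hself
      have hin := hs ((3 * ((i % 9 / 3 : ℕ) : ℝ) + ((i % 3 : ℕ) : ℝ) + s) / 9)
        ⟨by linarith [hs'.1], by linarith [hs'.2]⟩
      have harg : ((i : ℝ) + s) / 9 ^ (n + 1) = (((i / 9 : ℕ) : ℝ) +
          (3 * ((i % 9 / 3 : ℕ) : ℝ) + ((i % 3 : ℕ) : ℝ) + s) / 9) / 9 ^ n := by
        rw [hi0, pow_succ]
        field_simp
        ring
      rw [harg]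
      simp only [Int.cast_add, Int.cast_mul, Int.cast_sub, Int.cast_ite, Int.cast_natCast,
        Int.cast_one, Int.cast_ofNat, Int.cast_neg]
      linear_combination 3 * hin + (e (i / 9) : ℝ) * hself
    · by_cases h8 : i % 9 = 8
      · obtain ⟨k, rfl⟩ : ∃ k, i = 9 * k + 8 := ⟨i / 9, by omega⟩
        have e1 : (9 * k + 8) / 9 = k := by omega
        have e2 : (9 * k + 8 + 1) / 9 = k + 1 := by omega
        have e3 : (9 * k + 8 + 1) % 9 = 0 := by omega
        have e4 : (9 * k + 8 + 1) % 3 = 0 := by omega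
        have e5 : (9 * k + 8) % 3 = 2 := by omega
        rw [e1] at he hc
        have hc := hc (by rw [pow_succ] at hi'; omega)
        rw [isCellChange_nine_mul_add_eight]
        simp only [e1, e2, e3, e4, e5, h8]
        by_cases hZ : IsCellChange k
        · rw [if_pos hZ] at hc ⊢
          rw [hc.1, hc.2]
          norm_num
          ring
        · rw [if_neg hZ] at hc ⊢
          rw [hc.1, hc.2]
          norm_num
      · obtain ⟨k, j, hj, rfl⟩ : ∃ k j, j < 8 ∧ i = 9 * k + j :=
          ⟨i / 9, i % 9, by omega, by omega⟩
        rw [isCellChange_nine_mul_add_iff hj]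
        have e1 : (9 * k + j) / 9 = k := by omega
        have e2 : (9 * k + j + 1) / 9 = k := by omega
        have e3 : (9 * k + j + 1) % 9 = j + 1 := by omega
        have e4 : (9 * k + j + 1) % 3 = (j + 1) % 3 := by omega
        have e5 : (9 * k + j) % 3 = j % 3 := by omega
        have e6 : (9 * k + j) % 9 = j := by omega
        simp only [e1, e2, e3, e4, e5, e6]
        interval_cases j <;> norm_num

/-- The number of cell changes up to time block `m`. -/
def cellChanges (m : ℕ) : ℕ := Nat.count IsCellChange m

theorem cellChanges_zero : cellChanges 0 = 0 := Nat.count_zero _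

theorem cellChanges_succ (m : ℕ) :
    cellChanges (m + 1) = cellChanges m + if IsCellChange m then 1 else 0 :=
  Nat.count_succ _ m

theorem cellChanges_mono : Monotone cellChanges := Nat.count_monotone _

theorem cellChanges_add (k : ℕ) {j : ℕ} (hj : j ≤ 8) :
    cellChanges (9 * k + j) =
      cellChanges (9 * k) + (if 3 ≤ j then 1 else 0) + (if 6 ≤ j then 1 else 0) := by
  induction j with
  | zero => simp
  | succ j ih =>
    have := ih (by omega)
    have h2 := isCellChange_nine_mul_add_iff (k := k) (j := j) (by omega)
    rw [← add_assoc, cellChanges_succ]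
    grind

theorem cellChanges_nine_mul (k : ℕ) : cellChanges (9 * k) = 2 * k + cellChanges k := by
  induction k with
  | zero => simp [cellChanges_zero]
  | succ k ih =>
    have h : cellChanges (9 * (k + 1)) =
        cellChanges (9 * k + 8) + if IsCellChange k then 1 else 0 := by
      rw [show 9 * (k + 1) = 9 * k + 8 + 1 by ring, cellChanges_succ]
      simp only [isCellChange_nine_mul_add_eight]
    rw [h, cellChanges_add k le_rfl, ih, cellChanges_succ]
    simp
    ring

theorem abs_cellChanges_sub_le (n : ℕ) {m : ℕ} (hm : m < 9 ^ n) :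
    |(cellChanges m : ℝ) - m / 4| ≤ 2 * n := by
  induction n generalizing m with
  | zero =>
    obtain rfl : m = 0 := by simpa using hm
    simp [cellChanges_zero]
  | succ n ih =>
    obtain ⟨k, j, hj, rfl⟩ : ∃ k j, j ≤ 8 ∧ m = 9 * k + j :=
      ⟨m / 9, m % 9, by omega, by omega⟩
    have hk := ih (m := k) (by rw [pow_succ] at hm; omega)
    rw [cellChanges_add k hj, cellChanges_nine_mul]
    have hj' : (j : ℝ) ≤ 8 := by exact_mod_cast hj
    have hj0 : (0 : ℝ) ≤ j := j.cast_nonneg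
    rw [abs_le] at hk ⊢
    push_cast
    constructor <;> split_ifs <;> linarith [hk.1, hk.2]

/-- The `i`-th of `N` intervals of equal length partitioning `[0, 1]`. -/
abbrev timeBlock (N i : ℕ) : Set ℝ := Set.Icc ((i : ℝ) / N) (((i : ℝ) + 1) / N)

/-- On every time block `i < N` the function `x` meets the grid `cℤ + r` exactly in the value
`c * q i + r`, and `q` changes, by `±1`, precisely at cell changes. -/
structure GridBlocks (x : ℝ → ℝ) (c r : ℝ) (N : ℕ) (q : ℕ → ℤ) : Prop where
  continuousOn : ContinuousOn x (Set.Icc (0 : ℝ) 1)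
  pos : 0 < N
  c_pos : 0 < c
  exists_eq : ∀ i < N, ∃ t ∈ timeBlock N i, x t = c * q i + r
  eq_of_eq : ∀ i < N, ∀ t ∈ timeBlock N i, ∀ k : ℤ, x t = c * k + r → k = q i
  step : ∀ i, i + 1 < N → if IsCellChange i then |q (i + 1) - q i| = 1 else q (i + 1) = q i

theorem isClosed_affine_image_int {c : ℝ} (hc : c ≠ 0) (r : ℝ) (A : Set ℤ) :
    IsClosed ((fun k : ℤ => c * k + r) '' A) := by
  have h : Topology.IsClosedEmbedding ((affineHomeomorph c r hc) ∘ ((↑) : ℤ → ℝ)) :=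
    (affineHomeomorph c r hc).isClosedEmbedding.comp Int.isClosedEmbedding_coe_real
  exact h.isClosedMap A (isClosed_discrete A)

theorem exists_mem_timeBlock {N : ℕ} (hN : 0 < N) (i : ℕ) {t : ℝ}
    (ht : t ∈ Set.Icc ((i : ℝ) / N) 1) (hi : i < N) : ∃ j < N, i ≤ j ∧ t ∈ timeBlock N j := by
  have hN' : (0 : ℝ) < N := by exact_mod_cast hN
  have h1 : (i : ℝ) ≤ t * N := (div_le_iff₀ hN').1 ht.1
  have h0 : 0 ≤ t * N := le_trans (Nat.cast_nonneg i) h1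
  rcases lt_or_ge ⌊t * N⌋₊ N with h | h
  · exact ⟨⌊t * N⌋₊, h, Nat.le_floor h1, (div_le_iff₀ hN').2 (Nat.floor_le h0),
      (le_div_iff₀ hN').2 (Nat.lt_floor_add_one _).le⟩
  · have h2 : (N : ℝ) ≤ t * N := le_trans (by exact_mod_cast h) (Nat.floor_le h0)
    have h3 : ((N - 1 : ℕ) : ℝ) = N - 1 := by rw [Nat.cast_sub hN]; simp
    refine ⟨N - 1, by omega, by omega, (div_le_iff₀ hN').2 (by linarith),
      (le_div_iff₀ hN').2 ?_⟩
    nlinarith [ht.2]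

theorem timeBlock_subset {N i : ℕ} (hi : i < N) : timeBlock N i ⊆ Set.Icc (0 : ℝ) 1 := by
  have hN' : (0 : ℝ) < N := by exact_mod_cast Nat.zero_lt_of_lt hi
  have hi' : (i : ℝ) + 1 ≤ N := by exact_mod_cast hi
  exact Set.Icc_subset_Icc (by positivity) ((div_le_one hN').2 hi')

theorem le_of_mem_timeBlock {N i j : ℕ} (hij : i < j) {s t : ℝ} (hs : s ∈ timeBlock N i)
    (ht : t ∈ timeBlock N j) : s ≤ t := by
  have : (i : ℝ) + 1 ≤ j := by exact_mod_cast hij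
  exact hs.2.trans (le_trans (by gcongr) ht.1)

theorem sInf_coe_image_eq {S : Set ℝ} {a : ℝ} (h : IsLeast S a) :
    sInf (Real.toEReal '' S) = (a : EReal) :=
  IsLeast.csInf_eq ⟨⟨a, h.1, rfl⟩, by
    rintro _ ⟨b, hb, rfl⟩
    exact EReal.coe_le_coe_iff.2 (h.2 hb)⟩

namespace GridBlocks

variable {x : ℝ → ℝ} {c r : ℝ} {N : ℕ} {q : ℕ → ℤ}

theorem eq_of_count_eq (h : GridBlocks x c r N q) {a b : ℕ} (hab : a ≤ b) (hb : b < N)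
    (hK : cellChanges b = cellChanges a) : q b = q a := by
  induction b, hab using Nat.le_induction with
  | base => rfl
  | succ b hab ih =>
    have h1 : cellChanges a ≤ cellChanges b := cellChanges_mono hab
    have h2 := h.step b hb
    rw [cellChanges_succ] at hK
    by_cases hZ : IsCellChange b
    · rw [if_pos hZ] at hK
      omega
    · rw [if_neg hZ] at hK h2
      rw [h2, ih (by omega) (by simpa using hK)]

theorem abs_sub_of_count_eq_succ (h : GridBlocks x c r N q) {a b : ℕ} (hab : a ≤ b) (hb : b < N)
    (hK : cellChanges b = cellChanges a + 1) : |q b - q a| = 1 := by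
  induction b, hab using Nat.le_induction with
  | base => omega
  | succ b hab ih =>
    have h2 := h.step b hb
    rw [cellChanges_succ] at hK
    by_cases hZ : IsCellChange b
    · rw [if_pos hZ] at hK h2
      rwa [← h.eq_of_count_eq hab (by omega) (by simpa using hK)]
    · rw [if_neg hZ] at hK h2
      rw [h2, ih (by omega) (by simpa using hK)]

theorem exists_isLeast_hit (h : GridBlocks x c r N q) (A : Set ℤ) (τ : ℝ) (hτ : 0 ≤ τ) {j : ℕ}
    (hj : j < N) (hA : q j ∈ A) (hτj : ∀ t ∈ timeBlock N j, τ ≤ t)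
    (hlow : ∀ i < j, q i ∈ A → ∀ t ∈ timeBlock N i, t < τ) :
    ∃ τ' ∈ timeBlock N j, x τ' = c * q j + r ∧
      IsLeast {t | t ∈ Set.Icc τ 1 ∧ x t ∈ (fun k : ℤ => c * k + r) '' A} τ' := by
  set S := {t | t ∈ Set.Icc τ 1 ∧ x t ∈ (fun k : ℤ => c * k + r) '' A} with hS
  obtain ⟨u, hu, hxu⟩ := h.exists_eq j hj
  have huS : u ∈ S := ⟨⟨hτj u hu, (timeBlock_subset hj hu).2⟩, q j, hA, hxu.symm⟩
  have hclosed : IsClosed S :=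
    (h.continuousOn.mono (Set.Icc_subset_Icc_left hτ)).preimage_isClosed_of_isClosed isClosed_Icc
      (isClosed_affine_image_int h.c_pos.ne' r A)
  have hcomp : IsCompact S := isCompact_Icc.of_isClosed_subset hclosed fun t ht => ht.1
  obtain ⟨τ', hτ'⟩ := hcomp.exists_isLeast ⟨u, huS⟩
  obtain ⟨⟨hτ1, hτ2⟩, k, hkA, hk⟩ := hτ'.1
  obtain ⟨i, hi, -, hmem⟩ := exists_mem_timeBlock h.pos 0 (t := τ')
    ⟨by simpa using hτ.trans hτ1, hτ2⟩ h.pos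
  have hki := h.eq_of_eq i hi τ' hmem k hk.symm
  have hji : j ≤ i := by
    by_contra! hij
    exact absurd (hlow i hij (hki ▸ hkA) τ' hmem) (not_lt.2 hτ1)
  have hmem' : τ' ∈ timeBlock N j := by
    refine ⟨le_trans ?_ hmem.1, (hτ'.2 huS).trans hu.2⟩
    gcongr
  refine ⟨τ', hmem', ?_, hτ'⟩
  rw [← h.eq_of_eq j hj τ' hmem' k hk.symm]
  exact hk.symm

theorem lebTime_zero (h : GridBlocks x c r N q) :
    ∃ τ ∈ timeBlock N 0, x τ = c * q 0 + r ∧ lebTime x c r 0 = (τ : EReal) := by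
  obtain ⟨τ, hτ, hx, hl⟩ := h.exists_isLeast_hit Set.univ 0 le_rfl h.pos (Set.mem_univ _)
    (fun t ht => (timeBlock_subset h.pos ht).1) (by simp)
  refine ⟨τ, hτ, hx, ?_⟩
  rw [lebTime, ← sInf_coe_image_eq hl]
  simp [peanoGrid, eq_comm]

theorem lebTime_succ_eq (h : GridBlocks x c r N q) {m i : ℕ} {τ : ℝ}
    (hτ : lebTime x c r m = (τ : EReal)) (hx : x τ = c * q i + r) :
    lebTime x c r (m + 1) = sInf (Real.toEReal ''
      {t | t ∈ Set.Icc τ 1 ∧ x t ∈ (fun k : ℤ => c * k + r) '' {k | k ≠ q i}}) := by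
  rw [lebTime, hτ, if_neg (EReal.coe_ne_top τ), EReal.toReal_coe]
  congr 2
  ext t
  simp only [Set.mem_ofPred_eq, peanoGrid, Set.mem_image]
  refine and_congr_right fun _ => ⟨?_, ?_⟩
  · rintro ⟨⟨k, hk⟩, hne⟩
    exact ⟨k, fun hki => hne (by rw [hk, hki, hx]), hk.symm⟩
  · rintro ⟨k, hki, hk⟩
    refine ⟨⟨k, hk.symm⟩, fun he => hki ?_⟩
    rw [← hk, hx] at he
    have := mul_left_cancel₀ h.c_pos.ne' (add_right_cancel he)
    exact_mod_cast this

theorem lebTime_succ (h : GridBlocks x c r N q) {m i : ℕ} {τ : ℝ} (hi : i < N)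
    (hτ : lebTime x c r m = (τ : EReal)) (hτi : τ ∈ timeBlock N i) (hx : x τ = c * q i + r)
    (hK : cellChanges i < cellChanges (N - 1)) :
    ∃ j < N, i ≤ j ∧ cellChanges j = cellChanges i + 1 ∧ ∃ τ' ∈ timeBlock N j,
      x τ' = c * q j + r ∧ lebTime x c r (m + 1) = (τ' : EReal) := by
  have hex : ∃ j, cellChanges i < cellChanges j := ⟨_, hK⟩
  set j := Nat.find hex with hj
  have hj1 : cellChanges i < cellChanges j := Nat.find_spec hex
  have hjle : j ≤ N - 1 := Nat.find_min' hex hK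
  have hjN : j < N := by have := h.pos; omega
  have hmin : ∀ l < j, cellChanges l ≤ cellChanges i := fun l hl => not_lt.1 (Nat.find_min hex hl)
  have hij : i < j := cellChanges_mono.reflect_lt hj1
  have hj2 : cellChanges j = cellChanges i + 1 := by
    have h1 := hmin (j - 1) (by omega)
    have h2 : cellChanges (j - 1 + 1) ≤ cellChanges (j - 1) + 1 := by
      rw [cellChanges_succ]
      split_ifs <;> omega
    rw [Nat.sub_add_cancel (by omega)] at h2
    omega
  have hqj : q j ≠ q i := fun he => by
    have := h.abs_sub_of_count_eq_succ hij.le hjN hj2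
    simp [he] at this
  obtain ⟨τ', hτ', hx', hl⟩ := h.exists_isLeast_hit {k | k ≠ q i} τ (timeBlock_subset hi hτi).1
    hjN hqj (fun t ht => le_of_mem_timeBlock hij hτi ht) (fun l hl hql t ht => by
      have hli : l < i := by
        by_contra! hil
        exact hql (h.eq_of_count_eq hil (by omega)
          (le_antisymm (hmin l hl) (cellChanges_mono hil)))
      refine lt_of_le_of_ne (le_of_mem_timeBlock hli ht hτi) ?_
      rintro rfl
      exact hql (h.eq_of_eq l (by omega) t ht (q i) hx).symm)
  exact ⟨j, hjN, hij.le, hj2, τ', hτ', hx', by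
    rw [h.lebTime_succ_eq hτ hx, sInf_coe_image_eq hl]⟩

theorem lebTime_eq_top (h : GridBlocks x c r N q) {m i : ℕ} {τ : ℝ} (hi : i < N)
    (hτ : lebTime x c r m = (τ : EReal)) (hτi : τ ∈ timeBlock N i) (hx : x τ = c * q i + r)
    (hK : cellChanges i = cellChanges (N - 1)) : lebTime x c r (m + 1) = ⊤ := by
  rw [h.lebTime_succ_eq hτ hx]
  convert! sInf_empty
  rw [Set.image_eq_empty, Set.eq_empty_iff_forall_notMem]
  rintro t ⟨ht, k, hk, hkt⟩
  obtain ⟨j, hj, hij, htj⟩ := exists_mem_timeBlock h.pos i ⟨hτi.1.trans ht.1, ht.2⟩ hi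
  refine hk ?_
  rw [h.eq_of_eq j hj t htj k hkt.symm]
  have h1 : cellChanges i ≤ cellChanges j := cellChanges_mono hij
  have h2 : cellChanges j ≤ cellChanges (N - 1) := cellChanges_mono (by omega)
  exact h.eq_of_count_eq hij hj (by omega)

theorem exists_lebTime (h : GridBlocks x c r N q) {m : ℕ} (hm : m ≤ cellChanges (N - 1)) :
    ∃ i < N, cellChanges i = m ∧ ∃ τ ∈ timeBlock N i, x τ = c * q i + r ∧
      lebTime x c r m = (τ : EReal) := by
  induction m with
  | zero => exact ⟨0, h.pos, cellChanges_zero, h.lebTime_zero⟩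
  | succ m ih =>
    obtain ⟨i, hi, hK, τ, hτi, hx, hτ⟩ := ih (by omega)
    obtain ⟨j, hj, -, hKj, hrest⟩ := h.lebTime_succ hi hτ hτi hx (by omega)
    exact ⟨j, hj, by omega, hrest⟩

theorem lebTime_eq_top_of_lt (h : GridBlocks x c r N q) {m : ℕ} (hm : cellChanges (N - 1) < m) :
    lebTime x c r m = ⊤ := by
  induction m, hm using Nat.le_induction with
  | base =>
    obtain ⟨i, hi, hK, τ, hτi, hx, hτ⟩ := h.exists_lebTime le_rfl
    exact h.lebTime_eq_top hi hτ hτi hx hK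
  | succ m hm ih => rw [lebTime, if_pos ih]

theorem sq_sub_lebTime (h : GridBlocks x c r N q) {m : ℕ} (hm : m < cellChanges (N - 1)) :
    (x (lebTime x c r (m + 1)).toReal - x (lebTime x c r m).toReal) ^ 2 = c ^ 2 := by
  obtain ⟨i, hi, hK, τ, hτi, hx, hτ⟩ := h.exists_lebTime hm.le
  obtain ⟨j, hj, hij, hKj, τ', hτj, hx', hτ'⟩ := h.lebTime_succ hi hτ hτi hx (by omega)
  have hq := h.abs_sub_of_count_eq_succ hij hj hKj
  have hq' : ((q j : ℝ) - q i) ^ 2 = 1 := by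
    have : (q j - q i) ^ 2 = 1 := by rw [← sq_abs, hq, one_pow]
    exact_mod_cast this
  rw [hτ, hτ', EReal.toReal_coe, EReal.toReal_coe, hx, hx']
  linear_combination c ^ 2 * hq'

theorem kIdx_zero (h : GridBlocks x c r N q) : kIdx x c r 0 = 1 := by
  have hmem : 1 ∈ {m : ℕ | 1 ≤ m ∧ ((0 : ℝ) : EReal) ≤ lebTime x c r (m - 1)} := by
    obtain ⟨τ, hτ, -, hl⟩ := h.lebTime_zero
    refine ⟨le_rfl, ?_⟩
    rw [Nat.sub_self, hl]
    exact EReal.coe_le_coe_iff.2 (timeBlock_subset h.pos hτ).1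
  exact le_antisymm (Nat.sInf_le hmem) (Nat.sInf_mem ⟨1, hmem⟩).1

theorem abs_qvar0_sub_le (h : GridBlocks x c r N q) {t : ℝ} {i : ℕ} (hi : i < N)
    (ht : t ∈ timeBlock N i) : |qvar0 x c r t - c ^ 2 * cellChanges i| ≤ 2 * c ^ 2 := by
  set L := {m : ℕ | 1 ≤ m ∧ lebTime x c r (m - 1) ≤ (t : EReal)} with hL
  have hmono : cellChanges i ≤ cellChanges (N - 1) := cellChanges_mono (by omega)
  have hfin : ∀ m ∈ L, m ≤ cellChanges (N - 1) + 1 := fun m hm => by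
    by_contra! hlt
    have := hm.2
    rw [h.lebTime_eq_top_of_lt (by omega)] at this
    exact EReal.coe_ne_top t (top_le_iff.1 this)
  have hup : ∀ m ∈ L, m ≤ cellChanges i + 2 := fun m hm => by
    have hm1 := hfin m hm
    obtain ⟨j, hj, hK, τ, hτj, -, hτ⟩ := h.exists_lebTime (m := m - 1) (by omega)
    have hτt : τ ≤ t := by
      have := hm.2
      rwa [hτ, EReal.coe_le_coe_iff] at this
    have hji : j ≤ i + 1 := by
      have hN' : (0 : ℝ) < N := by exact_mod_cast h.pos
      have := (hτj.1.trans hτt).trans ht.2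
      rw [div_le_div_iff_of_pos_right hN'] at this
      exact_mod_cast this
    have h1 : cellChanges j ≤ cellChanges (i + 1) := cellChanges_mono hji
    rw [cellChanges_succ] at h1
    split_ifs at h1 <;> omega
  have hlow : ∀ m, 1 ≤ m → m ≤ cellChanges i → m ∈ L := fun m hm1 hm2 => by
    obtain ⟨j, hj, hK, τ, hτj, -, hτ⟩ := h.exists_lebTime (m := m - 1) (by omega)
    refine ⟨hm1, ?_⟩
    rw [hτ, EReal.coe_le_coe_iff]
    have hji : j < i := cellChanges_mono.reflect_lt (by omega)
    exact le_of_mem_timeBlock hji hτj ht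
  have hbdd : BddAbove L := ⟨_, hup⟩
  have hle : sSup L ≤ cellChanges i + 2 ∧ sSup L ≤ cellChanges (N - 1) + 1 := by
    rcases L.eq_empty_or_nonempty with he | hne
    · simp [he]
    · exact ⟨hup _ (Nat.sSup_mem hne hbdd), hfin _ (Nat.sSup_mem hne hbdd)⟩
  have hge : cellChanges i ≤ sSup L := by
    rcases Nat.eq_zero_or_pos (cellChanges i) with h0 | h0
    · omega
    · exact le_csSup hbdd (hlow _ h0 le_rfl)
  have hq : qvar0 x c r t = c ^ 2 * ((sSup L - 1 : ℕ) : ℝ) := by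
    rw [qvar0, qvar, h.kIdx_zero, lIdx, Finset.sum_congr rfl (g := fun _ => c ^ 2)]
    · simp [← hL, mul_comm]
    · intro m hm
      rw [Finset.mem_Ico, ← hL] at hm
      have := h.sq_sub_lebTime (m := m - 1) (by omega)
      rwa [Nat.sub_add_cancel hm.1] at this
  have h1 : ((sSup L - 1 : ℕ) : ℝ) ≤ cellChanges i + 2 := by exact_mod_cast (by omega)
  have h2 : (cellChanges i : ℝ) ≤ ((sSup L - 1 : ℕ) : ℝ) + 2 := by exact_mod_cast (by omega)
  rw [hq, ← mul_sub, abs_mul, abs_of_nonneg (sq_nonneg c), mul_comm]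
  gcongr
  rw [abs_le]
  constructor <;> linarith

end GridBlocks

theorem IsPeanoX.exists_gridBlocks {x : ℝ → ℝ} (hx : IsPeanoX x) (n : ℕ) {r : ℝ}
    (hr : ∀ m : ℤ, r ≠ (m : ℝ) / 3 ^ n) :
    ∃ q : ℕ → ℤ, GridBlocks x (1 / 3 ^ n) r (9 ^ n) q := by
  obtain ⟨p, e, h⟩ := hx.exists_blocks n
  have h3 : (0 : ℝ) < 3 ^ n := by positivity
  have h9 : (0 : ℝ) < 9 ^ n := by positivity
  have hρ1 : Int.fract (3 ^ n * r) < 1 := Int.fract_lt_one _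
  have hρ0 : 0 < Int.fract (3 ^ n * r) := by
    refine lt_of_le_of_ne (Int.fract_nonneg _) fun h0 => hr ⌊3 ^ n * r⌋ ?_
    have := Int.floor_add_fract (3 ^ n * r)
    rw [eq_div_iff h3.ne']
    linarith
  have hfl := Int.floor_add_fract (3 ^ n * r)
  set ρ := Int.fract (3 ^ n * r)
  refine ⟨fun i => p i - ⌊3 ^ n * r⌋, hx.continuousOn, by positivity, by positivity,
    fun i hi => ?_, fun i hi t ht k hk => ?_, fun i hi => ?_⟩
  · obtain ⟨he, hs, -⟩ := h i hi
    obtain ⟨y, hy, hey⟩ : ∃ y ∈ Set.Icc (0 : ℝ) 1, (e i : ℝ) * (2 * y - 1) = 2 * ρ - 1 := by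
      rcases he with he | he
      · exact ⟨ρ, ⟨hρ0.le, hρ1.le⟩, by rw [he]; simp⟩
      · exact ⟨1 - ρ, ⟨by linarith, by linarith⟩, by rw [he]; push_cast; ring⟩
    obtain ⟨s, hs', rfl⟩ := hx.surjOn hy
    refine ⟨(i + s) / 9 ^ n, ⟨?_, ?_⟩, ?_⟩
    · push_cast
      gcongr
      linarith [hs'.1]
    · push_cast
      gcongr
      exact hs'.2
    · have := hs s hs'
      rw [hey] at this
      push_cast
      field_simp
      linarith
  · obtain ⟨he, hs, -⟩ := h i hi
    have ht1 := ht.1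
    have ht2 := ht.2
    push_cast at ht1 ht2
    rw [div_le_iff₀ h9] at ht1
    rw [le_div_iff₀ h9] at ht2
    have hmem : t * 9 ^ n - i ∈ Set.Icc (0 : ℝ) 1 := ⟨by linarith, by linarith⟩
    have hy := hx.mem_Icc hmem
    have hblock := hs _ hmem
    have harg : ((i : ℝ) + (t * 9 ^ n - i)) / 9 ^ n = t := by field_simp; ring
    rw [harg, hk] at hblock
    have hk' : 2 * (k + 3 ^ n * r) = 2 * p i + 1 + e i * (2 * x (t * 9 ^ n - i) - 1) := by
      rw [← hblock]
      field_simp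
    have hbound : |(e i : ℝ) * (2 * x (t * 9 ^ n - i) - 1)| ≤ 1 := by
      rw [abs_le]
      rcases he with he | he <;> rw [he] <;> push_cast <;> constructor <;>
        linarith [hy.1, hy.2]
    rw [abs_le] at hbound
    have h1 : (k : ℝ) + ⌊3 ^ n * r⌋ - p i < 1 := by linarith [hbound.2]
    have h2 : -1 < (k : ℝ) + ⌊3 ^ n * r⌋ - p i := by linarith [hbound.1]
    have h1' : k + ⌊3 ^ n * r⌋ - p i < 1 := by exact_mod_cast h1
    have h2' : -1 < k + ⌊3 ^ n * r⌋ - p i := by exact_mod_cast h2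
    omega
  · obtain ⟨he, -, hc⟩ := h i (by omega)
    have hc := hc hi
    simp only [sub_sub_sub_cancel_right]
    split_ifs at hc ⊢
    · rcases he with he | he <;> simp [hc.1, he]
    · rw [hc.1]

theorem IsPeanoX.abs_qvar0_sub_le {x : ℝ → ℝ} (hx : IsPeanoX x) (n : ℕ) {r : ℝ}
    (hr : ∀ m : ℤ, r ≠ (m : ℝ) / 3 ^ n) {t : ℝ} (ht : t ∈ Set.Icc (0 : ℝ) 1) :
    |qvar0 x (1 / 3 ^ n) r t - t / 4| ≤ (2 * n + 3) * (1 / 9) ^ n := by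
  obtain ⟨q, h⟩ := hx.exists_gridBlocks n hr
  obtain ⟨i, hi, -, hti⟩ := exists_mem_timeBlock h.pos 0 (by simpa using ht) h.pos
  have hq := h.abs_qvar0_sub_le hi hti
  have hC := abs_cellChanges_sub_le n hi
  have h9 : (0 : ℝ) < 9 ^ n := by positivity
  have ht1 := hti.1
  have ht2 := hti.2
  push_cast at ht1 ht2
  rw [div_le_iff₀ h9] at ht1
  rw [le_div_iff₀ h9] at ht2
  have hc : ((1 : ℝ) / 3 ^ n) ^ 2 = (1 / 9) ^ n := by
    rw [← one_div_pow, ← pow_mul, mul_comm, pow_mul]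
    norm_num
  rw [hc] at hq
  have hinv : (9 : ℝ) ^ n * (1 / 9) ^ n = 1 := by
    rw [← mul_pow]
    norm_num
  have hδ : (0 : ℝ) < (1 / 9) ^ n := by positivity
  set δ : ℝ := (1 / 9) ^ n
  have hmid : |(cellChanges i : ℝ) - t * 9 ^ n / 4| ≤ 2 * n + 1 := by
    rw [abs_le] at hC ⊢
    constructor <;> linarith [hC.1, hC.2]
  calc |qvar0 x (1 / 3 ^ n) r t - t / 4|
      = |(qvar0 x (1 / 3 ^ n) r t - δ * cellChanges i) +
          δ * (cellChanges i - t * 9 ^ n / 4)| := by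
        congr 1
        linear_combination (t / 4) * hinv
    _ ≤ 2 * δ + δ * (2 * n + 1) := by
        refine (abs_add_le _ _).trans (add_le_add hq ?_)
        rw [abs_mul, abs_of_pos hδ]
        gcongr
    _ = (2 * n + 3) * δ := by ring

/-- The quadratic variations of the horizontal component of the Peano curve along the Lebesgue
partitions for the grids `3^{-n}ℤ + r_n`, where `r_n` is not an integer multiple of `3^{-n}`,
converge to `t/4`. -/
theorem peano_qvar_limit_basic_grid (x : ℝ → ℝ) (hx : IsPeanoX x)
    (r : ℕ → ℝ) (hr : ∀ n : ℕ, ∀ m : ℤ, r n ≠ (m : ℝ) / 3 ^ n)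
    (t : ℝ) (ht : t ∈ Set.Icc (0 : ℝ) 1) :
    Filter.Tendsto (fun n : ℕ => qvar0 x (1 / 3 ^ n) (r n) t) Filter.atTop
      (nhds (t / 4)) := by
  rw [tendsto_iff_norm_sub_tendsto_zero]
  refine squeeze_zero (fun _ => norm_nonneg _)
    (fun n => hx.abs_qvar0_sub_le n (hr n) ht) ?_
  have h1 : Tendsto (fun n : ℕ => (n : ℝ) * (1 / 9) ^ n) atTop (nhds 0) :=
    tendsto_self_mul_const_pow_of_lt_one (by norm_num) (by norm_num)
  have h2 : Tendsto (fun n : ℕ => ((1 : ℝ) / 9) ^ n) atTop (nhds 0) :=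
    tendsto_pow_atTop_nhds_zero_of_lt_one (by norm_num) (by norm_num)
  have h3 := (h1.const_mul 2).add (h2.const_mul 3)
  simp only [mul_zero, add_zero] at h3
  refine h3.congr fun n => ?_
  ring
end
end

section
/- Let x be the horizontal component of the Peano curve. Then the occupation measure of x over the whole interval [0,1] is the Lebesgue measure on [0,1]: for every bounded Borel-measurable g : ℝ → ℝ, ∫_0^1 g(x(s)) ds = ∫_0^1 g(z) dz; equivalently, the pushforward of Lebesgue measure on [0,1] under x is Lebesgue measure on [0,1] (i.e., the local time of x at time 1 equals 1 for every z ∈ (0,1)). -/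
open scoped BigOperators Classical
open Filter

noncomputable section

open MeasureTheory Set

/-- The digits of the horizontal component of the Peano curve, as elements of `Fin 3`. -/
def peanoDigits (d : ℕ → Fin 3) (m : ℕ) : Fin 3 :=
  Fin.rev^[∑ i ∈ Finset.range m, (d (2 * i + 1) : ℕ)] (d (2 * m))

/-- The horizontal component of the Peano curve on `[0,1)`, computed from the standard ternary
expansion. -/
def peanoHoriz (s : ℝ) : ℝ := Real.ofDigits (peanoDigits (Real.digits s 3))

/-- The reflection of `[0,1]` induced by an odd number of digit flips. -/
def flipBy (b : Fin 3) (z : ℝ) : ℝ := if b = 1 then 1 - z else z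

lemma coe_peanoDigits (d : ℕ → Fin 3) (m : ℕ) : (peanoDigits d m : ℕ) = peanoXDigit d m := by
  have h : Function.Semiconj (fun n : Fin 3 => (n : ℕ)) Fin.rev peanoK := by
    intro n
    fin_cases n <;> rfl
  exact h.iterate_right _ _

lemma IsPeanoX.apply_ofDigits {x : ℝ → ℝ} (hx : IsPeanoX x) (d : ℕ → Fin 3) :
    x (Real.ofDigits d) = Real.ofDigits (peanoDigits d) := by
  simpa [Real.ofDigits, Real.ofDigitsTerm, coe_peanoDigits, div_eq_mul_inv] using hx d

lemma IsPeanoX.eq_peanoHoriz {x : ℝ → ℝ} (hx : IsPeanoX x) {s : ℝ} (hs : s ∈ Ico (0 : ℝ) 1) :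
    x s = peanoHoriz s := by
  rw [peanoHoriz, ← hx.apply_ofDigits, Real.ofDigits_digits (by norm_num) hs]

lemma peanoHoriz_mem_Icc (s : ℝ) : peanoHoriz s ∈ Icc (0 : ℝ) 1 :=
  ⟨Real.ofDigits_nonneg _, Real.ofDigits_le_one _⟩

lemma measurable_peanoHoriz : Measurable peanoHoriz := by
  have hd : ∀ j, Measurable fun s : ℝ => Real.digits s 3 j := fun j =>
    (measurable_of_countable (Fin.ofNat 3)).comp
      (Nat.measurable_floor.comp (measurable_id.mul_const _))
  refine Real.continuous_ofDigits.measurable.comp (measurable_pi_lambda _ fun m => ?_)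
  have hsum : Measurable fun s : ℝ =>
      ∑ i ∈ Finset.range m, (Real.digits s 3 (2 * i + 1) : ℕ) :=
    Finset.measurable_sum _ fun i _ =>
      (measurable_of_countable fun n : Fin 3 => (n : ℕ)).comp (hd _)
  exact (measurable_of_countable fun p : ℕ × Fin 3 => Fin.rev^[p.1] p.2).comp
    (hsum.prodMk (hd _))

lemma ofDigits_rev (e : ℕ → Fin 3) :
    Real.ofDigits (fun i => Fin.rev (e i)) = 1 - Real.ofDigits e := by
  rw [← Real.ofDigits_const_last_eq_one 2, Real.ofDigits, Real.ofDigits, Real.ofDigits,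
    ← Summable.tsum_sub Real.summable_ofDigitsTerm Real.summable_ofDigitsTerm]
  refine tsum_congr fun i => ?_
  simp only [Real.ofDigitsTerm]
  generalize e i = n
  fin_cases n <;> (norm_num [Fin.rev, Fin.last]; try ring)

lemma ofDigits_rev_iterate (b : Fin 3) (e : ℕ → Fin 3) :
    Real.ofDigits (fun i => Fin.rev^[(b : ℕ)] (e i)) = flipBy b (Real.ofDigits e) := by
  fin_cases b
  · simp [flipBy]
  · simpa [flipBy] using ofDigits_rev e
  · simp [flipBy]

lemma IsPeanoX.apply_third {x : ℝ → ℝ} (hx : IsPeanoX x) (a b : Fin 3) {s : ℝ}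
    (hs : s ∈ Icc (0 : ℝ) 1) : x ((a + (b + s) / 3) / 3) = (a + flipBy b (x s)) / 3 := by
  obtain ⟨d, -, rfl⟩ := Real.ofDigits_SurjOn (b := 3) (by norm_num) hs
  let d' : ℕ → Fin 3 := fun n => Nat.casesOn n a fun n => Nat.casesOn n b d
  have harg : ((a : ℝ) + (b + Real.ofDigits d) / 3) / 3 = Real.ofDigits d' := by
    rw [Real.ofDigits_eq_sum_add_ofDigits d' 2]
    simp only [Finset.sum_range_succ, Finset.sum_range_zero, Real.ofDigitsTerm]
    change _ = 0 + (a : ℝ) * _ + (b : ℝ) * _ + _ * Real.ofDigits d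
    norm_num
    ring
  have htail : (fun i => peanoDigits d' (i + 1)) =
      fun i => Fin.rev^[(b : ℕ)] (peanoDigits d i) := by
    funext i
    rw [peanoDigits, peanoDigits, Finset.sum_range_succ', add_comm, Function.iterate_add_apply]
    rfl
  rw [harg, hx.apply_ofDigits, hx.apply_ofDigits,
    Real.ofDigits_eq_sum_add_ofDigits (peanoDigits d') 1, htail, ofDigits_rev_iterate]
  have h0 : peanoDigits d' 0 = a := rfl
  simp only [Finset.sum_range_one, Real.ofDigitsTerm, h0]
  norm_num
  ring

lemma peanoHoriz_third {x : ℝ → ℝ} (hx : IsPeanoX x) (a b : Fin 3) {s : ℝ}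
    (hs : s ∈ Ico (0 : ℝ) 1) :
    peanoHoriz ((a + (b + s) / 3) / 3) = (a + flipBy b (peanoHoriz s)) / 3 := by
  have mem : ∀ (c : Fin 3) {u : ℝ}, u ∈ Ico (0 : ℝ) 1 → ((c : ℝ) + u) / 3 ∈ Ico (0 : ℝ) 1 := by
    intro c u hu
    have hc : (c : ℝ) ≤ 2 := by exact_mod_cast Nat.le_of_lt_succ c.isLt
    have hc' : (0 : ℝ) ≤ c := by positivity
    constructor <;> linarith [hu.1, hu.2]
  rw [← hx.eq_peanoHoriz hs, ← hx.apply_third a b ⟨hs.1, hs.2.le⟩,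
    hx.eq_peanoHoriz (mem a (mem b hs))]

lemma intervalIntegrable_of_measurable_of_bound {f : ℝ → ℂ} (hf : Measurable f) {C : ℝ}
    (hC : ∀ u, ‖f u‖ ≤ C) (p q : ℝ) : IntervalIntegrable f volume p q := by
  rw [intervalIntegrable_iff]
  exact Measure.integrableOn_of_bounded (by simp) hf.aestronglyMeasurable
    (Filter.Eventually.of_forall hC)

lemma integral_eq_sum_thirds {f : ℝ → ℂ} (hf : Measurable f) {C : ℝ} (hC : ∀ u, ‖f u‖ ≤ C) :
    ∫ t in (0 : ℝ)..1, f t = (1 / 3) * ∑ a : Fin 3, ∫ t in (0 : ℝ)..1, f ((a + t) / 3) := by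
  have h := intervalIntegral.sum_integral_adjacent_intervals (f := f) (μ := volume)
    (a := fun k : ℕ => (k : ℝ) / 3) (n := 3)
    fun k _ => intervalIntegrable_of_measurable_of_bound hf hC _ _
  have hk : ∀ k : ℕ, ∫ t in (0 : ℝ)..1, f ((k + t) / 3) =
      3 * ∫ t in (k : ℝ) / 3..((k + 1 : ℕ) : ℝ) / 3, f t := by
    intro k
    simp_rw [add_div]
    rw [intervalIntegral.integral_comp_add_div f (by norm_num : (3 : ℝ) ≠ 0)]
    push_cast
    rw [Complex.real_smul]
    simp [add_div]
  have hsum : ∑ a : Fin 3, ∫ t in (0 : ℝ)..1, f ((a + t) / 3) =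
      ∑ k ∈ Finset.range 3, 3 * ∫ t in (k : ℝ) / 3..((k + 1 : ℕ) : ℝ) / 3, f t := by
    rw [Finset.sum_range]
    exact Finset.sum_congr rfl fun a _ => hk a
  rw [hsum, ← Finset.mul_sum, h]
  norm_num [← mul_assoc]

lemma integral_comp_flipBy (b : Fin 3) (f : ℝ → ℂ) :
    ∫ z in (0 : ℝ)..1, f (flipBy b z) = ∫ z in (0 : ℝ)..1, f z := by
  unfold flipBy
  split_ifs
  · simp
  · rfl

lemma integral_comp_peanoHoriz_eq {x : ℝ → ℝ} (hx : IsPeanoX x) {g : ℝ → ℂ} (hg : Measurable g)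
    {C : ℝ} (hC : ∀ u, ‖g u‖ ≤ C) :
    ∫ s in (0 : ℝ)..1, g (peanoHoriz s) = (1 / 9) * ∑ a : Fin 3, ∑ b : Fin 3,
      ∫ s in (0 : ℝ)..1, g ((a + flipBy b (peanoHoriz s)) / 3) := by
  have hm : Measurable fun s => g (peanoHoriz s) := hg.comp measurable_peanoHoriz
  have hstep : ∀ a b : Fin 3, ∫ s in (0 : ℝ)..1, g (peanoHoriz ((a + (b + s) / 3) / 3)) =
      ∫ s in (0 : ℝ)..1, g ((a + flipBy b (peanoHoriz s)) / 3) := fun a b =>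
    intervalIntegral.integral_congr_Ioo_of_le zero_le_one fun s hs => by
      simp only [peanoHoriz_third hx a b ⟨hs.1.le, hs.2⟩]
  rw [integral_eq_sum_thirds hm fun _ => hC _]
  simp_rw [← hstep]
  have hinner : ∀ a : Fin 3, ∫ t in (0 : ℝ)..1, g (peanoHoriz ((a + t) / 3)) =
      (1 / 3) * ∑ b : Fin 3, ∫ s in (0 : ℝ)..1, g (peanoHoriz ((a + (b + s) / 3) / 3)) :=
    fun a => integral_eq_sum_thirds (f := fun t => g (peanoHoriz ((a + t) / 3)))
      (hm.comp (by fun_prop)) fun _ => hC _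
  simp_rw [hinner, ← Finset.mul_sum]
  ring

lemma integral_eq_sum_flipBy {g : ℝ → ℂ} (hg : Measurable g) {C : ℝ} (hC : ∀ u, ‖g u‖ ≤ C) :
    ∫ z in (0 : ℝ)..1, g z = (1 / 9) * ∑ a : Fin 3, ∑ b : Fin 3,
      ∫ z in (0 : ℝ)..1, g ((a + flipBy b z) / 3) := by
  rw [integral_eq_sum_thirds hg hC]
  have h : ∀ a b : Fin 3, ∫ z in (0 : ℝ)..1, g ((a + flipBy b z) / 3) =
      ∫ z in (0 : ℝ)..1, g ((a + z) / 3) := fun a b =>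
    integral_comp_flipBy b fun z => g ((a + z) / 3)
  simp_rw [h]
  simp only [Finset.sum_const, Finset.card_univ, Fintype.card_fin, nsmul_eq_mul, ← Finset.mul_sum]
  push_cast
  ring

lemma dist_flipBy (b : Fin 3) (u v : ℝ) : dist (flipBy b u) (flipBy b v) = dist u v := by
  unfold flipBy
  split_ifs
  · exact dist_sub_left 1 u v
  · rfl

lemma norm_integral_peanoHoriz_sub_le {x : ℝ → ℝ} (hx : IsPeanoX x) {C : ℝ} (n : ℕ) :
    ∀ (g : ℝ → ℂ) (L : NNReal), LipschitzWith L g → (∀ u, ‖g u‖ ≤ C) →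
      ‖(∫ s in (0 : ℝ)..1, g (peanoHoriz s)) - ∫ z in (0 : ℝ)..1, g z‖ ≤ L / 3 ^ n := by
  induction n with
  | zero =>
    intro g L hL hC
    have hm := hL.continuous.measurable
    have hm' : Measurable fun s => g (peanoHoriz s) := hm.comp measurable_peanoHoriz
    rw [← intervalIntegral.integral_sub
      (intervalIntegrable_of_measurable_of_bound hm' (fun _ => hC _) _ _)
      (intervalIntegrable_of_measurable_of_bound hm hC _ _)]
    refine (intervalIntegral.norm_integral_le_of_norm_le_const (C := L) fun s hs => ?_).trans
      (by simp)
    rw [uIoc_of_le zero_le_one] at hs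
    have h := peanoHoriz_mem_Icc s
    rw [← dist_eq_norm]
    refine (hL.dist_le_mul _ _).trans (mul_le_of_le_one_right L.2 ?_)
    rw [Real.dist_eq, abs_le]
    constructor <;> linarith [h.1, h.2, hs.1, hs.2]
  | succ n ih =>
    intro g L hL hC
    have hm := hL.continuous.measurable
    rw [integral_comp_peanoHoriz_eq hx hm hC, integral_eq_sum_flipBy hm hC, ← mul_sub,
      ← Finset.sum_sub_distrib]
    simp_rw [← Finset.sum_sub_distrib]
    have hterm : ∀ a b : Fin 3, ‖(∫ s in (0 : ℝ)..1, g ((a + flipBy b (peanoHoriz s)) / 3)) -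
        ∫ z in (0 : ℝ)..1, g ((a + flipBy b z) / 3)‖ ≤ ((L / 3 : NNReal) : ℝ) / 3 ^ n := by
      intro a b
      refine ih (fun z => g ((a + flipBy b z) / 3)) (L / 3)
        (LipschitzWith.of_dist_le_mul fun u v => ?_) fun _ => hC _
      refine (hL.dist_le_mul _ _).trans_eq ?_
      have h3 : dist (((a : ℝ) + flipBy b u) / 3) ((a + flipBy b v) / 3) = dist u v / 3 := by
        rw [← dist_flipBy b u v, Real.dist_eq, Real.dist_eq, ← sub_div, add_sub_add_left_eq_sub,
          abs_div, abs_of_pos (by norm_num : (0 : ℝ) < 3)]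
      rw [h3]
      push_cast
      ring
    have hsum := norm_sum_le_of_le Finset.univ fun a _ =>
      norm_sum_le_of_le Finset.univ fun b _ => hterm a b
    rw [norm_mul]
    refine (mul_le_mul_of_nonneg_left hsum (norm_nonneg _)).trans_eq ?_
    simp only [Finset.sum_const, Finset.card_univ, Fintype.card_fin, nsmul_eq_mul]
    norm_num
    ring

lemma integral_comp_peanoHoriz {x : ℝ → ℝ} (hx : IsPeanoX x) {g : ℝ → ℂ} {L : NNReal}
    (hL : LipschitzWith L g) {C : ℝ} (hC : ∀ u, ‖g u‖ ≤ C) :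
    ∫ s in (0 : ℝ)..1, g (peanoHoriz s) = ∫ z in (0 : ℝ)..1, g z := by
  rw [← sub_eq_zero, ← norm_le_zero_iff]
  have hlim : Tendsto (fun n : ℕ => (L : ℝ) / 3 ^ n) atTop (nhds 0) := by
    simpa using (tendsto_pow_atTop_nhds_zero_of_lt_one (by norm_num : (0 : ℝ) ≤ 1 / 3)
      (by norm_num)).const_mul (L : ℝ) |>.congr fun n => by rw [one_div, inv_pow, div_eq_mul_inv]
  exact ge_of_tendsto' hlim fun n => norm_integral_peanoHoriz_sub_le hx n g L hL hC

lemma lipschitzWith_exp_mul_I (t : ℝ) :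
    LipschitzWith ‖t‖₊ fun z : ℝ => Complex.exp (t * z * Complex.I) := by
  refine LipschitzWith.of_dist_le_mul fun u v => ?_
  have h : Complex.exp (t * u * Complex.I) - Complex.exp (t * v * Complex.I) =
      Complex.exp ((t * v : ℝ) * Complex.I) *
        (Complex.exp (Complex.I * (t * (u - v) : ℝ)) - 1) := by
    rw [mul_sub, ← Complex.exp_add, mul_one]
    push_cast
    ring_nf
  rw [dist_eq_norm, h, norm_mul, Complex.norm_exp_ofReal_mul_I, one_mul]
  refine Real.norm_exp_I_mul_ofReal_sub_one_le.trans_eq ?_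
  rw [norm_mul, coe_nnnorm, dist_eq_norm]

lemma map_peanoHoriz {x : ℝ → ℝ} (hx : IsPeanoX x) :
    (volume.restrict (Ioc (0 : ℝ) 1)).map peanoHoriz = volume.restrict (Ioc (0 : ℝ) 1) := by
  refine Measure.ext_of_charFun (funext fun t => ?_)
  rw [charFun_apply_real, charFun_apply_real, integral_map measurable_peanoHoriz.aemeasurable
    (lipschitzWith_exp_mul_I t).continuous.aestronglyMeasurable,
    ← intervalIntegral.integral_of_le zero_le_one, ← intervalIntegral.integral_of_le zero_le_one]
  refine integral_comp_peanoHoriz hx (lipschitzWith_exp_mul_I t) (C := 1) fun u => ?_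
  rw [← Complex.ofReal_mul, Complex.norm_exp_ofReal_mul_I]

/-- The occupation measure of the horizontal component of the Peano curve over the whole time
interval `[0,1]` is the Lebesgue measure on `[0,1]`: for every bounded Borel `g`,
`∫_0^1 g(x(s)) ds = ∫_0^1 g(z) dz`. -/
theorem peano_occupation_measure_at_one (x : ℝ → ℝ) (hx : IsPeanoX x) :
    ∀ g : ℝ → ℝ, Measurable g → (∃ C : ℝ, ∀ z, |g z| ≤ C) →
      ∫ s in (0 : ℝ)..1, g (x s) = ∫ z in (0 : ℝ)..1, g z := by
  intro g hg _
  rw [intervalIntegral.integral_congr_Ioo_of_le (g := fun s => g (peanoHoriz s)) zero_le_one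
      fun s hs => by simp only [hx.eq_peanoHoriz ⟨hs.1.le, hs.2⟩],
    intervalIntegral.integral_of_le zero_le_one, intervalIntegral.integral_of_le zero_le_one,
    ← integral_map measurable_peanoHoriz.aemeasurable hg.aestronglyMeasurable, map_peanoHoriz hx]
end
end
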